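/- Let Γ be an ordinal, M = (W,R,V) a Kripke model, w₀ ∈ W, and φ₀ a sentence of the modal μ-calculus in normal form. Then M,w₀ ⊨^Γ φ₀ (Γ-bounded compositional semantics) if and only if Eloise has a winning strategy in the Γ-bounded evaluation game (M, w₀, φ₀, Γ). -/

import Mathlib

/-- Formulae of the modal μ-calculus, with negation only on proposition symbols:
`φ ::= p | ¬p | X | φ∨φ | φ∧φ | ◇φ | □φ | μX φ | νX φ`. -/
inductive Formula (Φ Λ : Type) : Type
  | atom  : Φ → Formula Φ Λ
  | natom : Φ → Formula Φ Λ
  | label : Λ → Formula Φ Λ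
  | or    : Formula Φ Λ → Formula Φ Λ → Formula Φ Λ
  | and   : Formula Φ Λ → Formula Φ Λ → Formula Φ Λ
  | dia   : Formula Φ Λ → Formula Φ Λ
  | box   : Formula Φ Λ → Formula Φ Λ
  | mu    : Λ → Formula Φ Λ → Formula Φ Λ
  | nu    : Λ → Formula Φ Λ → Formula Φ Λ

/-- A Kripke model `M = (W,R,V)` over the (nonempty) set `W` of worlds. -/
structure Kripke (Φ W : Type) where
  R : W → W → Prop
  V : Φ → Set W

variable {Φ Λ W : Type}
/-- The γ-th lower ordinal approximation of an operator `F : 𝒫(W) → 𝒫(W)`: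
`F_μ^0 = ∅`, `F_μ^{γ+1} = F(F_μ^γ)`, and `F_μ^λ = ⋃_{δ<λ} F_μ^δ` for limit `λ`. -/
noncomputable def approxMu {W : Type} (F : Set W → Set W) (γ : Ordinal) : Set W :=
  Ordinal.limitRecOn γ ∅ (fun _ ih => F ih)
    (fun γ' _ ih => ⋃ δ : {δ : Ordinal // δ < γ'}, ih δ.1 δ.2)

/-- The γ-th upper ordinal approximation of an operator `F : 𝒫(W) → 𝒫(W)`:
`F_ν^0 = W`, `F_ν^{γ+1} = F(F_ν^γ)`, and `F_ν^λ = ⋂_{δ<λ} F_ν^δ` for limit `λ`. -/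
noncomputable def approxNu {W : Type} (F : Set W → Set W) (γ : Ordinal) : Set W :=
  Ordinal.limitRecOn γ Set.univ (fun _ ih => F ih)
    (fun γ' _ ih => ⋂ δ : {δ : Ordinal // δ < γ'}, ih δ.1 δ.2)
/-- Γ-bounded compositional semantics: as the standard semantics, except that
`μX ψ` (resp. `νX ψ`) is interpreted by the Γ-th lower (resp. upper) ordinal
approximation of the operator `A ↦ bsat M Γ ψ (s[A/X])`. -/
noncomputable def bsat [DecidableEq Λ] (M : Kripke Φ W) (Γ : Ordinal) :
    Formula Φ Λ → (Λ → Set W) → Set W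
  | .atom p, _ => M.V p
  | .natom p, _ => (M.V p)ᶜ
  | .label X, s => s X
  | .or φ ψ, s => bsat M Γ φ s ∪ bsat M Γ ψ s
  | .and φ ψ, s => bsat M Γ φ s ∩ bsat M Γ ψ s
  | .dia φ, s => {w | ∃ v, M.R w v ∧ v ∈ bsat M Γ φ s}
  | .box φ, s => {w | ∀ v, M.R w v → v ∈ bsat M Γ φ s}
  | .mu X φ, s => approxMu (fun A => bsat M Γ φ (Function.update s X A)) Γ
  | .nu X φ, s => approxNu (fun A => bsat M Γ φ (Function.update s X A)) Γ
/-- The set of label symbols occurring free in a formula. -/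
def freeLabels : Formula Φ Λ → Set Λ
  | .atom _ => ∅
  | .natom _ => ∅
  | .label X => {X}
  | .or φ ψ => freeLabels φ ∪ freeLabels ψ
  | .and φ ψ => freeLabels φ ∪ freeLabels ψ
  | .dia φ => freeLabels φ
  | .box φ => freeLabels φ
  | .mu X φ => freeLabels φ \ {X}
  | .nu X φ => freeLabels φ \ {X}

/-- A sentence is a formula with no free label symbols. -/
def IsSentence (φ : Formula Φ Λ) : Prop := freeLabels φ = ∅

/-- The list of label symbols bound by the μ- and ν-operator occurrences of a formula
(with multiplicity). -/
def binderList : Formula Φ Λ → List Λ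
  | .atom _ => []
  | .natom _ => []
  | .label _ => []
  | .or φ ψ => binderList φ ++ binderList ψ
  | .and φ ψ => binderList φ ++ binderList ψ
  | .dia φ => binderList φ
  | .box φ => binderList φ
  | .mu X φ => X :: binderList φ
  | .nu X φ => X :: binderList φ

/-- A formula is in normal form if each label symbol occurs at most once bound by a
μ- or ν-operator in it. -/
def NormalForm (φ : Formula Φ Λ) : Prop := (binderList φ).Nodup
open scoped Classical

/-- The two players of the evaluation game. -/
inductive Player : Type
  | eloise
  | abelard
deriving DecidableEq

/-- A position `(w, φ, c)` of a Γ-bounded evaluation game for a sentence `φ₀`: a world `w`,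
an occurrence of a subformula of `φ₀` (represented by its address `addr` in the syntax tree
of `φ₀`), and a clock mapping `c` assigning ordinals to (addresses of) subformula
occurrences of `φ₀`. -/
structure GPos (W : Type) where
  world : W
  addr : List ℕ
  clock : List ℕ → Ordinal

/-- The subformula occurrence of `φ` at address `o` in its syntax tree
(`0` = left/unique child, `1` = right child), if any. -/
def nodeAt : Formula Φ Λ → List ℕ → Option (Formula Φ Λ)
  | φ, [] => some φ
  | .or φ _, 0 :: t => nodeAt φ t
  | .or _ ψ, 1 :: t => nodeAt ψ t
  | .and φ _, 0 :: t => nodeAt φ t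
  | .and _ ψ, 1 :: t => nodeAt ψ t
  | .dia φ, 0 :: t => nodeAt φ t
  | .box φ, 0 :: t => nodeAt φ t
  | .mu _ φ, 0 :: t => nodeAt φ t
  | .nu _ φ, 0 :: t => nodeAt φ t
  | _, _ => none

/-- Whether the occurrence at address `o` in `φ₀` is a μν-subformula occurrence. -/
def muNuAt (φ₀ : Formula Φ Λ) (o : List ℕ) : Bool :=
  match nodeAt φ₀ o with
  | some (.mu _ _) => true
  | some (.nu _ _) => true
  | _ => false

/-- Whether the occurrence at address `o` in `φ₀` is of the form `μX ψ` or `νX ψ`. -/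
def bindsAt [DecidableEq Λ] (φ₀ : Formula Φ Λ) (X : Λ) (o : List ℕ) : Bool :=
  match nodeAt φ₀ o with
  | some (.mu Y _) => decide (Y = X)
  | some (.nu Y _) => decide (Y = X)
  | _ => false

/-- The (address of the) reference formula `rf(X)` of an occurrence of the label `X`
at address `o` in `φ₀`: the innermost (longest) binder `μX ψ` / `νX ψ` on the branch
from the root to `o`. -/
def refOcc [DecidableEq Λ] (φ₀ : Formula Φ Λ) (X : Λ) (o : List ℕ) : Option (List ℕ) :=
  (o.inits.filter (fun o' => bindsAt φ₀ X o')).getLast?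

/-- The player (if any) to move at a position: Eloise resolves `∨`, `◇`, `μ` and labels
bound by `μ`; Abelard resolves `∧`, `□`, `ν` and labels bound by `ν`; nobody moves at
literals. -/
def turn [DecidableEq Λ] (φ₀ : Formula Φ Λ) (p : GPos W) : Option Player :=
  match nodeAt φ₀ p.addr with
  | some (.or _ _) => some .eloise
  | some (.and _ _) => some .abelard
  | some (.dia _) => some .eloise
  | some (.box _) => some .abelard
  | some (.mu _ _) => some .eloise
  | some (.nu _ _) => some .abelard
  | some (.label X) =>
      match (refOcc φ₀ X p.addr).bind (nodeAt φ₀) with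
      | some (.mu _ _) => some .eloise
      | some (.nu _ _) => some .abelard
      | _ => none
  | _ => none

/-- The clock mapping after a move at a label occurrence whose reference formula sits at
address `r`: the clock of `r` becomes `γ'`, clocks of all μν-subformula occurrences of the
body of the reference formula are reset to `Γ`, all other clocks are unchanged. -/
def clockReset (Γ γ' : Ordinal) (r : List ℕ) (c : List ℕ → Ordinal) : List ℕ → Ordinal :=
  fun o => if o = r then γ' else if (r ++ [0]).isPrefixOf o then Γ else c o

/-- The set of positions reachable from `p` in one round of the Γ-bounded evaluation game
for `φ₀` on `M`, according to the rules of the game. -/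
def moves [DecidableEq Λ] (M : Kripke Φ W) (φ₀ : Formula Φ Λ) (Γ : Ordinal)
    (p : GPos W) : Set (GPos W) :=
  match nodeAt φ₀ p.addr with
  | some (.or _ _) => {⟨p.world, p.addr ++ [0], p.clock⟩, ⟨p.world, p.addr ++ [1], p.clock⟩}
  | some (.and _ _) => {⟨p.world, p.addr ++ [0], p.clock⟩, ⟨p.world, p.addr ++ [1], p.clock⟩}
  | some (.dia _) => {q | ∃ v, M.R p.world v ∧ q = ⟨v, p.addr ++ [0], p.clock⟩}
  | some (.box _) => {q | ∃ v, M.R p.world v ∧ q = ⟨v, p.addr ++ [0], p.clock⟩}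
  | some (.mu _ _) =>
      {q | ∃ γ < Γ, q = ⟨p.world, p.addr ++ [0], Function.update p.clock p.addr γ⟩}
  | some (.nu _ _) =>
      {q | ∃ γ < Γ, q = ⟨p.world, p.addr ++ [0], Function.update p.clock p.addr γ⟩}
  | some (.label X) =>
      match refOcc φ₀ X p.addr with
      | some r => {q | ∃ γ' < p.clock r, q = ⟨p.world, r ++ [0], clockReset Γ γ' r p.clock⟩}
      | none => ∅
  | _ => ∅

/-- The winner of the game at an ending position: at `(w,p,c)` Eloise wins iff `w ∈ V(p)`,
at `(w,¬p,c)` iff `w ∉ V(p)`; at any other position with no available moves, the player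
who should move loses (so Abelard wins at `◇` with no successor and at labels bound by `μ`
with clock value `0`, and dually for Eloise). -/
noncomputable def winsTerminal [DecidableEq Λ] (M : Kripke Φ W) (φ₀ : Formula Φ Λ)
    (p : GPos W) : Player :=
  match nodeAt φ₀ p.addr with
  | some (.atom q) => if p.world ∈ M.V q then .eloise else .abelard
  | some (.natom q) => if p.world ∈ M.V q then .abelard else .eloise
  | _ =>
      match turn φ₀ p with
      | some .eloise => .abelard
      | _ => .eloise

/-- The initial position `(w₀, φ₀, c₀)` of the game, where `c₀` is constantly `Γ`. -/
def initPos (w₀ : W) (Γ : Ordinal) : GPos W := ⟨w₀, [], fun _ => Γ⟩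

/-- `ConsPlay M φ₀ Γ w₀ P σ f` : the finite sequence of positions `f` is a (partial) play of
the Γ-bounded evaluation game `(M, w₀, φ₀, Γ)` in which player `P` follows the positional
strategy `σ`: it starts at the initial position, every step obeys the rules of the game,
and at every position where `P` moves, the move is the one prescribed by `σ`. -/
def ConsPlay [DecidableEq Λ] (M : Kripke Φ W) (φ₀ : Formula Φ Λ) (Γ : Ordinal) (w₀ : W)
    (P : Player) (σ : GPos W → GPos W) (f : List (GPos W)) : Prop :=
  f.head? = some (initPos w₀ Γ) ∧
    ∀ i, (h : i + 1 < f.length) →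
      f[i + 1] ∈ moves M φ₀ Γ (f[i]'(Nat.lt_of_succ_lt h)) ∧
        (turn φ₀ (f[i]'(Nat.lt_of_succ_lt h)) = some P →
          f[i + 1] = σ (f[i]'(Nat.lt_of_succ_lt h)))

/-- `WinStrat M φ₀ Γ w₀ P σ` : the (positional) strategy `σ` is a winning strategy for
player `P` in the Γ-bounded evaluation game `(M, w₀, φ₀, Γ)`: along any play in which `P`
follows `σ`, whenever it is `P`'s turn and some move is available, `σ` prescribes a legal
move (so `P` can always continue playing according to `σ`), and every ending position ever
reached is winning for `P`. -/
noncomputable def WinStrat [DecidableEq Λ] (M : Kripke Φ W) (φ₀ : Formula Φ Λ)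
    (Γ : Ordinal) (w₀ : W) (P : Player) (σ : GPos W → GPos W) : Prop :=
  ∀ f, ConsPlay M φ₀ Γ w₀ P σ f → ∀ p, f.getLast? = some p →
    (turn φ₀ p = some P → (moves M φ₀ Γ p).Nonempty → σ p ∈ moves M φ₀ Γ p) ∧
      (moves M φ₀ Γ p = ∅ → winsTerminal M φ₀ p = P)

/-! ### Ordinal approximations of monotone operators -/

theorem approxMu_zero (F : Set W → Set W) : approxMu F 0 = ∅ :=
  Ordinal.limitRecOn_zero ..

theorem approxMu_succ (F : Set W → Set W) (γ : Ordinal) :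
    approxMu F (γ + 1) = F (approxMu F γ) :=
  Ordinal.limitRecOn_add_one ..

theorem approxMu_limit (F : Set W → Set W) {γ : Ordinal} (h : Order.IsSuccLimit γ) :
    approxMu F γ = ⋃ δ : {δ : Ordinal // δ < γ}, approxMu F δ.1 :=
  Ordinal.limitRecOn_limit _ _ _ _ h

theorem approxNu_zero (F : Set W → Set W) : approxNu F 0 = Set.univ :=
  Ordinal.limitRecOn_zero ..

theorem approxNu_succ (F : Set W → Set W) (γ : Ordinal) :
    approxNu F (γ + 1) = F (approxNu F γ) :=
  Ordinal.limitRecOn_add_one ..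

theorem approxNu_limit (F : Set W → Set W) {γ : Ordinal} (h : Order.IsSuccLimit γ) :
    approxNu F γ = ⋂ δ : {δ : Ordinal // δ < γ}, approxNu F δ.1 :=
  Ordinal.limitRecOn_limit _ _ _ _ h

theorem approxNu_eq_compl_approxMu (F : Set W → Set W) (γ : Ordinal) :
    approxNu F γ = (approxMu (fun A => (F Aᶜ)ᶜ) γ)ᶜ := by
  induction γ using Ordinal.limitRecOn with
  | zero => simp [approxNu_zero, approxMu_zero]
  | add_one γ ih => rw [approxNu_succ, approxMu_succ, ih, compl_compl]
  | limit γ h ih =>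
    rw [approxNu_limit F h, approxMu_limit _ h, Set.compl_iUnion]
    exact Set.iInter_congr fun δ => ih δ.1 δ.2

theorem monotone_dual {F : Set W → Set W} (hF : Monotone F) :
    Monotone fun A => (F Aᶜ)ᶜ := fun _ _ h =>
  Set.compl_subset_compl.2 (hF (Set.compl_subset_compl.2 h))

theorem mem_approxMu {F : Set W → Set W} (hF : Monotone F) (γ : Ordinal) (w : W) :
    w ∈ approxMu F γ ↔ ∃ δ < γ, w ∈ F (approxMu F δ) := by
  induction γ using WellFoundedLT.induction generalizing w with
  | ind γ ih =>
    rcases Ordinal.zero_or_succ_or_isSuccLimit γ with rfl | ⟨δ, rfl⟩ | h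
    · simp [approxMu_zero]
    · rw [Order.succ_eq_add_one, approxMu_succ]
      refine ⟨fun hw => ⟨δ, Order.lt_succ δ, hw⟩, ?_⟩
      rintro ⟨ε, hε, hw⟩
      refine hF (fun v hv => ?_) hw
      obtain ⟨ζ, hζ, hv⟩ := (ih ε hε v).1 hv
      exact (ih δ (Order.lt_succ δ) v).2 ⟨ζ, hζ.trans_le (Order.lt_succ_iff.1 hε), hv⟩
    · rw [approxMu_limit F h, Set.mem_iUnion]
      constructor
      · rintro ⟨⟨δ, hδ⟩, hw⟩
        obtain ⟨ε, hε, hw⟩ := (ih δ hδ w).1 hw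
        exact ⟨ε, hε.trans hδ, hw⟩
      · rintro ⟨δ, hδ, hw⟩
        rw [← approxMu_succ F, ← Order.succ_eq_add_one] at hw
        exact ⟨⟨_, h.succ_lt hδ⟩, hw⟩

theorem mem_approxNu {F : Set W → Set W} (hF : Monotone F) (γ : Ordinal) (w : W) :
    w ∈ approxNu F γ ↔ ∀ δ < γ, w ∈ F (approxNu F δ) := by
  simp [approxNu_eq_compl_approxMu, mem_approxMu (monotone_dual hF)]

theorem approxMu_mono {F G : Set W → Set W} (hF : Monotone F) (h : F ≤ G) (γ : Ordinal) :
    approxMu F γ ⊆ approxMu G γ := by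
  induction γ using Ordinal.limitRecOn with
  | zero => simp [approxMu_zero]
  | add_one γ ih => rw [approxMu_succ, approxMu_succ]; exact (hF ih).trans (h _)
  | limit γ hγ ih =>
    rw [approxMu_limit F hγ, approxMu_limit G hγ]
    exact Set.iUnion_mono fun δ => ih δ.1 δ.2

theorem approxNu_mono {F G : Set W → Set W} (hG : Monotone G) (h : F ≤ G) (γ : Ordinal) :
    approxNu F γ ⊆ approxNu G γ := by
  rw [approxNu_eq_compl_approxMu, approxNu_eq_compl_approxMu]
  exact Set.compl_subset_compl.2
    (approxMu_mono (monotone_dual hG) (fun A => Set.compl_subset_compl.2 (h Aᶜ)) γ)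

theorem bsat_mono [DecidableEq Λ] (M : Kripke Φ W) (Γ : Ordinal) (φ : Formula Φ Λ) :
    Monotone (bsat M Γ φ) := by
  induction φ with
  | atom p => exact fun _ _ _ => le_rfl
  | natom p => exact fun _ _ _ => le_rfl
  | label X => exact fun _ _ h => h X
  | or φ ψ ihφ ihψ => exact fun _ _ h => Set.union_subset_union (ihφ h) (ihψ h)
  | and φ ψ ihφ ihψ => exact fun _ _ h => Set.inter_subset_inter (ihφ h) (ihψ h)
  | dia φ ih => exact fun _ _ h _ ⟨v, hv, hw⟩ => ⟨v, hv, ih h hw⟩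
  | box φ ih => exact fun _ _ h _ hw v hv => ih h (hw v hv)
  | mu X φ ih =>
    exact fun s t h => approxMu_mono (fun _ _ hA => ih (update_le_update_iff.2
      ⟨hA, fun _ _ => le_rfl⟩)) (fun _ => ih (update_le_update_iff.2
      ⟨le_rfl, fun _ _ => h _⟩)) Γ
  | nu X φ ih =>
    exact fun s t h => approxNu_mono (fun _ _ hA => ih (update_le_update_iff.2
      ⟨hA, fun _ _ => le_rfl⟩)) (fun _ => ih (update_le_update_iff.2
      ⟨le_rfl, fun _ _ => h _⟩)) Γ

theorem bsat_update_mono [DecidableEq Λ] (M : Kripke Φ W) (Γ : Ordinal) (φ : Formula Φ Λ)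
    (s : Λ → Set W) (X : Λ) : Monotone fun A => bsat M Γ φ (Function.update s X A) :=
  fun _ _ h => bsat_mono M Γ φ (update_le_update_iff.2 ⟨h, fun _ _ => le_rfl⟩)

/-! ### Addresses and reference formulae -/

theorem nodeAt_append (φ : Formula Φ Λ) (a b : List ℕ) :
    nodeAt φ (a ++ b) = (nodeAt φ a).bind (nodeAt · b) := by
  induction φ generalizing a <;> rcases a with _ | ⟨_ | _ | i, t⟩ <;> simp_all [nodeAt]

theorem nodeAt_child {φ ψ χ : Formula Φ Λ} {a : List ℕ} {i : ℕ}
    (h : nodeAt φ a = some ψ) (hi : nodeAt ψ [i] = some χ) :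
    nodeAt φ (a ++ [i]) = some χ := by
  simpa [nodeAt_append, h] using hi

theorem bindsAt_iff [DecidableEq Λ] {φ : Formula Φ Λ} {X : Λ} {a : List ℕ} :
    bindsAt φ X a = true ↔
      ∃ ψ, nodeAt φ a = some (.mu X ψ) ∨ nodeAt φ a = some (.nu X ψ) := by
  rw [bindsAt]
  split <;> simp_all

theorem refOcc_nil [DecidableEq Λ] (φ : Formula Φ Λ) (X : Λ) :
    refOcc φ X [] = if bindsAt φ X [] then some [] else none := by
  by_cases h : bindsAt φ X [] <;> simp [refOcc, h]

theorem refOcc_snoc [DecidableEq Λ] (φ : Formula Φ Λ) (X : Λ) (a : List ℕ) (i : ℕ) :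
    refOcc φ X (a ++ [i]) =
      if bindsAt φ X (a ++ [i]) then some (a ++ [i]) else refOcc φ X a := by
  by_cases h : bindsAt φ X (a ++ [i]) <;> simp [refOcc, List.inits_append, h]

theorem refOcc_of_bindsAt [DecidableEq Λ] {φ : Formula Φ Λ} {X : Λ} {a : List ℕ}
    (h : bindsAt φ X a = true) : refOcc φ X a = some a := by
  cases a using List.reverseRecOn with
  | nil => simp [refOcc_nil, h]
  | append_singleton a i => simp [refOcc_snoc, h]

theorem bindsAt_of_refOcc [DecidableEq Λ] {φ : Formula Φ Λ} {X : Λ} {a r : List ℕ}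
    (h : refOcc φ X a = some r) : bindsAt φ X r = true :=
  (List.mem_filter.1 (List.mem_of_getLast? h)).2

theorem prefix_of_refOcc [DecidableEq Λ] {φ : Formula Φ Λ} {X : Λ} {a r : List ℕ}
    (h : refOcc φ X a = some r) : r <+: a :=
  (List.mem_inits _ _).1 (List.mem_filter.1 (List.mem_of_getLast? h)).1

theorem exists_refOcc_of_mem_freeLabels [DecidableEq Λ] {φ : Formula Φ Λ}
    (hφ : IsSentence φ) {X : Λ} (a : List ℕ) {ψ : Formula Φ Λ} (hψ : nodeAt φ a = some ψ)
    (hX : X ∈ freeLabels ψ) : ∃ r, refOcc φ X a = some r := by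
  induction a using List.reverseRecOn generalizing ψ with
  | nil =>
    simp only [nodeAt, Option.some.injEq] at hψ
    subst hψ
    rw [hφ] at hX
    exact hX.elim
  | append_singleton a i ih =>
    suffices h : ∃ r, refOcc φ X a = some r by
      rw [refOcc_snoc]
      split
      · exact ⟨_, rfl⟩
      · exact h
    obtain hχ | ⟨χ, hχ⟩ := Option.eq_none_or_eq_some (nodeAt φ a)
    · simp [nodeAt_append, hχ] at hψ
    by_cases hb : bindsAt φ X a
    · exact ⟨a, refOcc_of_bindsAt hb⟩
    refine ih hχ ?_
    rw [nodeAt_append, hχ, Option.bind_some] at hψ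
    rw [bindsAt_iff] at hb
    cases χ <;> rcases i with _ | _ | i <;> simp_all [nodeAt, freeLabels] <;> grind

/-! ### Termination of the game -/

/-- Two clock mappings agree on all addresses strictly above `a`. -/
def AgreeAbove (a : List ℕ) (c c' : List ℕ → Ordinal) : Prop :=
  ∀ o, o <+: a → o ≠ a → c o = c' o

theorem AgreeAbove.of_snoc {a : List ℕ} {i : ℕ} {c c' : List ℕ → Ordinal}
    (h : AgreeAbove (a ++ [i]) c c') : AgreeAbove a c c' := fun o ho _ =>
  h o (ho.trans (List.prefix_append _ _)) fun h' => by simpa [h'] using ho.length_le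

theorem AgreeAbove.eq_of_snoc {a : List ℕ} {i : ℕ} {c c' : List ℕ → Ordinal}
    (h : AgreeAbove (a ++ [i]) c c') : c a = c' a :=
  h a (List.prefix_append _ _) (by simp)

theorem AgreeAbove.trans {a : List ℕ} {c c' c'' : List ℕ → Ordinal}
    (h : AgreeAbove a c c') (h' : AgreeAbove a c' c'') : AgreeAbove a c c'' :=
  fun o ho ho' => (h o ho ho').trans (h' o ho ho')

theorem agreeAbove_update (a : List ℕ) (c : List ℕ → Ordinal) (γ : Ordinal) :
    AgreeAbove a (Function.update c a γ) c :=
  fun _ _ ho => Function.update_of_ne ho _ _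

theorem clockReset_self (Γ γ : Ordinal) (r : List ℕ) (c : List ℕ → Ordinal) :
    clockReset Γ γ r c r = γ := by
  simp [clockReset]

theorem agreeAbove_clockReset (Γ γ : Ordinal) (r : List ℕ) (c : List ℕ → Ordinal) :
    AgreeAbove r (clockReset Γ γ r c) c := by
  intro o ho hne
  have : ¬ (r ++ [0]) <+: o := fun h => by
    have := h.length_le.trans ho.length_le
    simp at this
  simp [clockReset, hne, this]

/-- No infinite play starts in a label occurrence whose reference formula lies strictly above
`a`, provided the clock mapping agrees with `c` strictly above `a`. -/
def OuterLabelsAcc [DecidableEq Λ] (M : Kripke Φ W) (φ₀ : Formula Φ Λ) (Γ : Ordinal)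
    (a : List ℕ) (c : List ℕ → Ordinal) : Prop :=
  ∀ w' a' c' X r, nodeAt φ₀ a' = some (.label X) → refOcc φ₀ X a' = some r →
    r <+: a → r ≠ a → AgreeAbove a c' c → Acc (fun q p => q ∈ moves M φ₀ Γ p) ⟨w', a', c'⟩

theorem OuterLabelsAcc.child [DecidableEq Λ] {M : Kripke Φ W} {φ₀ : Formula Φ Λ}
    {Γ : Ordinal} {a : List ℕ} {c : List ℕ → Ordinal} (H : OuterLabelsAcc M φ₀ Γ a c)
    (ha : ∀ X, bindsAt φ₀ X a = false) (i : ℕ) : OuterLabelsAcc M φ₀ Γ (a ++ [i]) c := by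
  intro w' a' c' X r hX hr hra hne hc
  refine H w' a' c' X r hX hr ((List.prefix_concat_iff.1 hra).resolve_left hne) ?_ hc.of_snoc
  rintro rfl
  simpa [ha X] using bindsAt_of_refOcc hr

theorem acc_body [DecidableEq Λ] {M : Kripke Φ W} {φ₀ : Formula Φ Λ}
    {Γ : Ordinal} {a : List ℕ} {c : List ℕ → Ordinal} (H : OuterLabelsAcc M φ₀ Γ a c)
    (hbody : ∀ w c', OuterLabelsAcc M φ₀ Γ (a ++ [0]) c' →
      Acc (fun q p => q ∈ moves M φ₀ Γ p) ⟨w, a ++ [0], c'⟩)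
    (γ : Ordinal) (w : W) (c' : List ℕ → Ordinal) (hγ : c' a = γ) (hc : AgreeAbove a c' c) :
    Acc (fun q p => q ∈ moves M φ₀ Γ p) ⟨w, a ++ [0], c'⟩ := by
  induction γ using WellFoundedLT.induction generalizing w c' with
  | ind γ ih =>
    refine hbody w c' fun w' a' d X r hX hr hra hne hd => ?_
    by_cases h : r = a
    · subst h
      refine ⟨_, fun q hq => ?_⟩
      simp only [moves, hX, hr] at hq
      obtain ⟨γ', hγ', rfl⟩ := hq
      rw [hd.eq_of_snoc, hγ] at hγ'
      exact ih γ' hγ' _ _ (clockReset_self ..)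
        (AgreeAbove.trans (agreeAbove_clockReset Γ γ' r d) (hd.of_snoc.trans hc))
    · exact H w' a' d X r hX hr ((List.prefix_concat_iff.1 hra).resolve_left hne) h
        (hd.of_snoc.trans hc)

theorem acc_of_outerLabelsAcc [DecidableEq Λ] (M : Kripke Φ W) (φ₀ : Formula Φ Λ)
    (Γ : Ordinal) (ψ : Formula Φ Λ) (a : List ℕ) (hψ : nodeAt φ₀ a = some ψ) (w : W)
    (c : List ℕ → Ordinal) (H : OuterLabelsAcc M φ₀ Γ a c) :
    Acc (fun q p => q ∈ moves M φ₀ Γ p) ⟨w, a, c⟩ := by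
  induction ψ generalizing a w c with
  | atom p => exact ⟨_, fun q hq => by simp [moves, hψ] at hq⟩
  | natom p => exact ⟨_, fun q hq => by simp [moves, hψ] at hq⟩
  | label X =>
    cases hr : refOcc φ₀ X a with
    | none => exact ⟨_, fun q hq => by simp [moves, hψ, hr] at hq⟩
    | some r =>
      refine H w a c X r hψ hr (prefix_of_refOcc hr) ?_ fun _ _ _ => rfl
      rintro rfl
      simpa [bindsAt, hψ] using bindsAt_of_refOcc hr
  | or φ ψ ihφ ihψ =>
    have hb : ∀ X, bindsAt φ₀ X a = false := fun X => by simp [bindsAt, hψ]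
    refine ⟨_, fun q hq => ?_⟩
    simp only [moves, hψ] at hq
    rcases hq with rfl | rfl
    · exact ihφ _ (nodeAt_child hψ (by simp [nodeAt])) _ _ (H.child hb 0)
    · exact ihψ _ (nodeAt_child hψ (by simp [nodeAt])) _ _ (H.child hb 1)
  | and φ ψ ihφ ihψ =>
    have hb : ∀ X, bindsAt φ₀ X a = false := fun X => by simp [bindsAt, hψ]
    refine ⟨_, fun q hq => ?_⟩
    simp only [moves, hψ] at hq
    rcases hq with rfl | rfl
    · exact ihφ _ (nodeAt_child hψ (by simp [nodeAt])) _ _ (H.child hb 0)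
    · exact ihψ _ (nodeAt_child hψ (by simp [nodeAt])) _ _ (H.child hb 1)
  | dia φ ih =>
    have hb : ∀ X, bindsAt φ₀ X a = false := fun X => by simp [bindsAt, hψ]
    refine ⟨_, fun q hq => ?_⟩
    simp only [moves, hψ] at hq
    obtain ⟨v, -, rfl⟩ := hq
    exact ih _ (nodeAt_child hψ (by simp [nodeAt])) _ _ (H.child hb 0)
  | box φ ih =>
    have hb : ∀ X, bindsAt φ₀ X a = false := fun X => by simp [bindsAt, hψ]
    refine ⟨_, fun q hq => ?_⟩
    simp only [moves, hψ] at hq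
    obtain ⟨v, -, rfl⟩ := hq
    exact ih _ (nodeAt_child hψ (by simp [nodeAt])) _ _ (H.child hb 0)
  | mu X φ ih =>
    refine ⟨_, fun q hq => ?_⟩
    simp only [moves, hψ] at hq
    obtain ⟨γ, -, rfl⟩ := hq
    exact acc_body H (ih _ (nodeAt_child hψ (by simp [nodeAt]))) _ _ _ rfl (agreeAbove_update a c γ)
  | nu X φ ih =>
    refine ⟨_, fun q hq => ?_⟩
    simp only [moves, hψ] at hq
    obtain ⟨γ, -, rfl⟩ := hq
    exact acc_body H (ih _ (nodeAt_child hψ (by simp [nodeAt]))) _ _ _ rfl (agreeAbove_update a c γ)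

theorem acc_initPos [DecidableEq Λ] (M : Kripke Φ W) (φ₀ : Formula Φ Λ) (Γ : Ordinal)
    (w₀ : W) : Acc (fun q p => q ∈ moves M φ₀ Γ p) (initPos w₀ Γ) :=
  acc_of_outerLabelsAcc M φ₀ Γ φ₀ [] (by simp [nodeAt]) w₀ _
    fun _ _ _ _ _ _ _ h hne => absurd (List.prefix_nil.1 h) hne

/-! ### Truth of positions -/

/-- The assignment at the occurrence whose reversed address is given: every label bound above
the occurrence is interpreted by the approximant that the clock of its binder prescribes. -/
noncomputable def envRev [DecidableEq Λ] (M : Kripke Φ W) (Γ : Ordinal) (φ₀ : Formula Φ Λ)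
    (s : Λ → Set W) (c : List ℕ → Ordinal) : List ℕ → Λ → Set W
  | [] => s
  | _ :: t =>
    match nodeAt φ₀ t.reverse with
    | some (.mu X ψ) => Function.update (envRev M Γ φ₀ s c t) X
        (approxMu (fun A => bsat M Γ ψ (Function.update (envRev M Γ φ₀ s c t) X A))
          (c t.reverse))
    | some (.nu X ψ) => Function.update (envRev M Γ φ₀ s c t) X
        (approxNu (fun A => bsat M Γ ψ (Function.update (envRev M Γ φ₀ s c t) X A))
          (c t.reverse))
    | _ => envRev M Γ φ₀ s c t

/-- The assignment at the occurrence with address `a`, see `envRev`. -/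
noncomputable def env [DecidableEq Λ] (M : Kripke Φ W) (Γ : Ordinal) (φ₀ : Formula Φ Λ)
    (s : Λ → Set W) (c : List ℕ → Ordinal) (a : List ℕ) : Λ → Set W :=
  envRev M Γ φ₀ s c a.reverse

/-- The approximant that the clock mapping `c` prescribes for the binder at address `r`. -/
noncomputable def refVal [DecidableEq Λ] (M : Kripke Φ W) (Γ : Ordinal) (φ₀ : Formula Φ Λ)
    (s : Λ → Set W) (c : List ℕ → Ordinal) (r : List ℕ) : Set W :=
  match nodeAt φ₀ r with
  | some (.mu X ψ) =>
      approxMu (fun A => bsat M Γ ψ (Function.update (env M Γ φ₀ s c r) X A)) (c r)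
  | some (.nu X ψ) =>
      approxNu (fun A => bsat M Γ ψ (Function.update (env M Γ φ₀ s c r) X A)) (c r)
  | _ => ∅

section Env

variable [DecidableEq Λ] {M : Kripke Φ W} {Γ : Ordinal} {φ₀ : Formula Φ Λ} {s : Λ → Set W}
  {c c' : List ℕ → Ordinal} {a r : List ℕ} {X : Λ} {ψ : Formula Φ Λ}

theorem env_snoc_mu (h : nodeAt φ₀ a = some (.mu X ψ)) (i : ℕ) :
    env M Γ φ₀ s c (a ++ [i]) = Function.update (env M Γ φ₀ s c a) X
      (approxMu (fun A => bsat M Γ ψ (Function.update (env M Γ φ₀ s c a) X A)) (c a)) := by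
  simp [env, envRev, h]

theorem env_snoc_nu (h : nodeAt φ₀ a = some (.nu X ψ)) (i : ℕ) :
    env M Γ φ₀ s c (a ++ [i]) = Function.update (env M Γ φ₀ s c a) X
      (approxNu (fun A => bsat M Γ ψ (Function.update (env M Γ φ₀ s c a) X A)) (c a)) := by
  simp [env, envRev, h]

theorem env_snoc (hb : ∀ X, bindsAt φ₀ X a = false) (i : ℕ) :
    env M Γ φ₀ s c (a ++ [i]) = env M Γ φ₀ s c a := by
  simp only [bindsAt] at hb
  simp only [env, List.reverse_append, List.reverse_cons, List.reverse_nil, List.nil_append,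
    List.cons_append, envRev, List.reverse_reverse]
  split <;> simp_all

theorem env_snoc_apply_of_bindsAt (hb : bindsAt φ₀ X a = true) (i : ℕ) :
    env M Γ φ₀ s c (a ++ [i]) X = refVal M Γ φ₀ s c a := by
  obtain ⟨ψ, h | h⟩ := bindsAt_iff.1 hb
  · simp [env_snoc_mu h, refVal, h]
  · simp [env_snoc_nu h, refVal, h]

theorem env_snoc_apply_of_not_bindsAt (hb : ¬ bindsAt φ₀ X a = true) (i : ℕ) :
    env M Γ φ₀ s c (a ++ [i]) X = env M Γ φ₀ s c a X := by
  by_cases h : ∃ Y, bindsAt φ₀ Y a = true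
  · obtain ⟨Y, hY⟩ := h
    have hne : X ≠ Y := by
      rintro rfl
      exact hb hY
    obtain ⟨ψ, h | h⟩ := bindsAt_iff.1 hY
    · simp [env_snoc_mu h, hne]
    · simp [env_snoc_nu h, hne]
  · rw [env_snoc (by simpa using h)]

theorem env_congr (h : AgreeAbove a c c') : env M Γ φ₀ s c a = env M Γ φ₀ s c' a := by
  induction a using List.reverseRecOn with
  | nil => rfl
  | append_singleton a i ih =>
    have ih := ih h.of_snoc
    by_cases hb : ∃ Y, bindsAt φ₀ Y a = true
    · obtain ⟨Y, hY⟩ := hb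
      obtain ⟨ψ, h' | h'⟩ := bindsAt_iff.1 hY
      · rw [env_snoc_mu h', env_snoc_mu h', ih, h.eq_of_snoc]
      · rw [env_snoc_nu h', env_snoc_nu h', ih, h.eq_of_snoc]
    · rw [env_snoc (by simpa using hb), env_snoc (by simpa using hb), ih]

theorem env_snoc_apply_of_refOcc (h : refOcc φ₀ X a = some r) (i : ℕ) :
    env M Γ φ₀ s c (a ++ [i]) X = refVal M Γ φ₀ s c r := by
  induction a using List.reverseRecOn generalizing i with
  | nil =>
    rw [refOcc_nil] at h
    split at h
    · obtain rfl := Option.some.inj h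
      exact env_snoc_apply_of_bindsAt ‹_› i
    · simp at h
  | append_singleton a j ih =>
    rw [refOcc_snoc] at h
    split at h
    · obtain rfl := Option.some.inj h
      exact env_snoc_apply_of_bindsAt ‹_› i
    · rw [env_snoc_apply_of_not_bindsAt ‹_›, ih h]

theorem env_apply_of_refOcc (ha : ¬ bindsAt φ₀ X a = true) (h : refOcc φ₀ X a = some r) :
    env M Γ φ₀ s c a X = refVal M Γ φ₀ s c r := by
  rw [← env_snoc_apply_of_not_bindsAt ha 0, env_snoc_apply_of_refOcc h]

end Env

/-- A position is true if its world satisfies its subformula occurrence under the assignment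
prescribed by its clock mapping. -/
def PosTrue [DecidableEq Λ] (M : Kripke Φ W) (Γ : Ordinal) (φ₀ : Formula Φ Λ)
    (s : Λ → Set W) (p : GPos W) : Prop :=
  ∀ ψ, nodeAt φ₀ p.addr = some ψ → p.world ∈ bsat M Γ ψ (env M Γ φ₀ s p.clock p.addr)

section PosTrue

variable [DecidableEq Λ] {M : Kripke Φ W} {Γ : Ordinal} {φ₀ : Formula Φ Λ} {s : Λ → Set W}

theorem posTrue_iff {p : GPos W} {ψ : Formula Φ Λ} (h : nodeAt φ₀ p.addr = some ψ) :
    PosTrue M Γ φ₀ s p ↔ p.world ∈ bsat M Γ ψ (env M Γ φ₀ s p.clock p.addr) := by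
  simp [PosTrue, h]

theorem posTrue_child_iff {w : W} {a : List ℕ} {c : List ℕ → Ordinal} {χ ψ : Formula Φ Λ}
    (h : nodeAt φ₀ a = some χ) (hb : ∀ X, bindsAt φ₀ X a = false) {i : ℕ}
    (hi : nodeAt χ [i] = some ψ) :
    PosTrue M Γ φ₀ s ⟨w, a ++ [i], c⟩ ↔ w ∈ bsat M Γ ψ (env M Γ φ₀ s c a) := by
  rw [posTrue_iff (nodeAt_child h hi), env_snoc hb]

theorem posTrue_mu_body_iff {w : W} {a : List ℕ} {c c' : List ℕ → Ordinal} {X : Λ}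
    {ψ : Formula Φ Λ} (h : nodeAt φ₀ a = some (.mu X ψ)) (hc : AgreeAbove a c' c) :
    PosTrue M Γ φ₀ s ⟨w, a ++ [0], c'⟩ ↔
      w ∈ bsat M Γ ψ (Function.update (env M Γ φ₀ s c a) X
        (approxMu (fun A => bsat M Γ ψ (Function.update (env M Γ φ₀ s c a) X A)) (c' a))) := by
  rw [posTrue_iff (ψ := ψ) (nodeAt_child h (by simp [nodeAt])), env_snoc_mu h, env_congr hc]

theorem posTrue_nu_body_iff {w : W} {a : List ℕ} {c c' : List ℕ → Ordinal} {X : Λ}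
    {ψ : Formula Φ Λ} (h : nodeAt φ₀ a = some (.nu X ψ)) (hc : AgreeAbove a c' c) :
    PosTrue M Γ φ₀ s ⟨w, a ++ [0], c'⟩ ↔
      w ∈ bsat M Γ ψ (Function.update (env M Γ φ₀ s c a) X
        (approxNu (fun A => bsat M Γ ψ (Function.update (env M Γ φ₀ s c a) X A)) (c' a))) := by
  rw [posTrue_iff (ψ := ψ) (nodeAt_child h (by simp [nodeAt])), env_snoc_nu h, env_congr hc]

/-- Truth of a position is determined by the truth of its successors, according to the player
to move; if nobody is to move, the position is terminal and truth decides the winner. -/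
theorem posTrue_local (hφ₀ : IsSentence φ₀) (p : GPos W) :
    (turn φ₀ p = some .eloise ∧ (winsTerminal M φ₀ p = .abelard) ∧
      (PosTrue M Γ φ₀ s p ↔ ∃ q ∈ moves M φ₀ Γ p, PosTrue M Γ φ₀ s q)) ∨
    (turn φ₀ p = some .abelard ∧ (winsTerminal M φ₀ p = .eloise) ∧
      (PosTrue M Γ φ₀ s p ↔ ∀ q ∈ moves M φ₀ Γ p, PosTrue M Γ φ₀ s q)) ∨
    (turn φ₀ p = none ∧ moves M φ₀ Γ p = ∅ ∧
      (PosTrue M Γ φ₀ s p ↔ winsTerminal M φ₀ p = .eloise)) := by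
  obtain ⟨w, a, c⟩ := p
  cases hψ : nodeAt φ₀ a with
  | none => simp [turn, moves, winsTerminal, PosTrue, hψ]
  | some ψ =>
  rw [posTrue_iff (p := ⟨w, a, c⟩) hψ]
  cases ψ with
  | atom q => by_cases hw : w ∈ M.V q <;> simp [turn, moves, winsTerminal, hψ, bsat, hw]
  | natom q => by_cases hw : w ∈ M.V q <;> simp [turn, moves, winsTerminal, hψ, bsat, hw]
  | or φ ψ =>
    have hb : ∀ X, bindsAt φ₀ X a = false := fun X => by simp [bindsAt, hψ]
    simp [turn, moves, winsTerminal, hψ, bsat,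
      posTrue_child_iff hψ hb (i := 0) (ψ := φ) (by simp [nodeAt]),
      posTrue_child_iff hψ hb (i := 1) (ψ := ψ) (by simp [nodeAt])]
  | and φ ψ =>
    have hb : ∀ X, bindsAt φ₀ X a = false := fun X => by simp [bindsAt, hψ]
    simp [turn, moves, winsTerminal, hψ, bsat,
      posTrue_child_iff hψ hb (i := 0) (ψ := φ) (by simp [nodeAt]),
      posTrue_child_iff hψ hb (i := 1) (ψ := ψ) (by simp [nodeAt])]
  | dia φ =>
    have hb : ∀ X, bindsAt φ₀ X a = false := fun X => by simp [bindsAt, hψ]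
    simp [turn, moves, winsTerminal, hψ, bsat,
      posTrue_child_iff hψ hb (i := 0) (ψ := φ) (by simp [nodeAt])]
  | box φ =>
    have hb : ∀ X, bindsAt φ₀ X a = false := fun X => by simp [bindsAt, hψ]
    simp [turn, moves, winsTerminal, hψ, bsat, forall_comm (α := GPos W),
      posTrue_child_iff hψ hb (i := 0) (ψ := φ) (by simp [nodeAt])]
  | mu X φ =>
    simp [turn, moves, winsTerminal, hψ, bsat, mem_approxMu (bsat_update_mono ..),
      posTrue_mu_body_iff hψ (agreeAbove_update a c _)]
  | nu X φ =>
    simp [turn, moves, winsTerminal, hψ, bsat, forall_comm (α := GPos W),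
      mem_approxNu (bsat_update_mono ..),
      posTrue_nu_body_iff hψ (agreeAbove_update a c _)]
  | label X =>
    obtain ⟨r, hr⟩ := exists_refOcc_of_mem_freeLabels hφ₀ a hψ (X := X) (by simp [freeLabels])
    have hval := env_apply_of_refOcc (M := M) (Γ := Γ) (s := s) (c := c)
      (by simp [bindsAt, hψ]) hr
    obtain ⟨χ, h | h⟩ := bindsAt_iff.1 (bindsAt_of_refOcc hr)
    · simp [turn, moves, winsTerminal, hψ, hr, h, bsat, hval, refVal,
        mem_approxMu (bsat_update_mono ..), clockReset_self,
        posTrue_mu_body_iff h (agreeAbove_clockReset Γ _ r c)]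
    · simp [turn, moves, winsTerminal, hψ, hr, h, bsat, hval, refVal,
        mem_approxNu (bsat_update_mono ..), forall_comm (α := GPos W), clockReset_self,
        posTrue_nu_body_iff h (agreeAbove_clockReset Γ _ r c)]

theorem posTrue_initPos {w₀ : W} :
    PosTrue M Γ φ₀ s (initPos w₀ Γ) ↔ w₀ ∈ bsat M Γ φ₀ s := by
  rw [posTrue_iff (p := initPos w₀ Γ) (ψ := φ₀) (by simp [initPos, nodeAt])]
  rfl

/-! ### Strategies -/

theorem ConsPlay.snoc {w₀ : W} {P : Player} {σ : GPos W → GPos W} {f : List (GPos W)}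
    (hf : ConsPlay M φ₀ Γ w₀ P σ f) {p q : GPos W} (hp : f.getLast? = some p)
    (hq : q ∈ moves M φ₀ Γ p) (hσ : turn φ₀ p = some P → q = σ p) :
    ConsPlay M φ₀ Γ w₀ P σ (f ++ [q]) := by
  refine ⟨by simp [List.head?_append, hf.1], fun i hi => ?_⟩
  by_cases h : i + 1 < f.length
  · simpa [List.getElem_append, h, Nat.lt_of_succ_lt h] using hf.2 i h
  · have hlen : i + 1 = f.length := by simp at hi; omega
    have hi' : i < f.length := by omega
    have hfi : f[i] = p := by
      rw [List.getLast?_eq_getElem?, ← hlen] at hp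
      simpa [List.getElem?_eq_getElem hi'] using hp
    simpa [List.getElem_append, hlen, hi', hfi] using ⟨hq, hσ⟩

theorem ConsPlay.posTrue_getElem (hφ₀ : IsSentence φ₀) {w₀ : W} {σ : GPos W → GPos W}
    (h₀ : PosTrue M Γ φ₀ s (initPos w₀ Γ))
    (hσ : ∀ p, (∃ q ∈ moves M φ₀ Γ p, PosTrue M Γ φ₀ s q) → PosTrue M Γ φ₀ s (σ p))
    {f : List (GPos W)} (hf : ConsPlay M φ₀ Γ w₀ .eloise σ f) (i : ℕ) (hi : i < f.length) :
    PosTrue M Γ φ₀ s f[i] := by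
  induction i with
  | zero =>
    have := hf.1
    rw [List.head?_eq_getElem?, List.getElem?_eq_getElem hi, Option.some.injEq] at this
    rwa [this]
  | succ i ih =>
    have ih := ih (Nat.lt_of_succ_lt hi)
    obtain ⟨hmove, hturn⟩ := hf.2 i hi
    obtain ⟨ht, -, h⟩ | ⟨-, -, h⟩ | ⟨-, hm, -⟩ :=
      posTrue_local (M := M) (Γ := Γ) (s := s) hφ₀ (f[i]'(Nat.lt_of_succ_lt hi))
    · rw [hturn ht]
      exact hσ _ (h.1 ih)
    · exact h.1 ih _ hmove
    · simp [hm] at hmove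

theorem exists_winStrat_of_posTrue (hφ₀ : IsSentence φ₀) {w₀ : W}
    (h₀ : PosTrue M Γ φ₀ s (initPos w₀ Γ)) : ∃ σ, WinStrat M φ₀ Γ w₀ .eloise σ := by
  choose! σ hσ using fun (p : GPos W) (h : ∃ q ∈ moves M φ₀ Γ p, PosTrue M Γ φ₀ s q) => h
  refine ⟨σ, fun f hf p hp => ?_⟩
  have hpt : PosTrue M Γ φ₀ s p := by
    obtain ⟨i, hi, rfl⟩ := List.mem_iff_getElem.1 (List.mem_of_getLast? hp)
    exact hf.posTrue_getElem hφ₀ h₀ (fun p hp => (hσ p hp).2) i hi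
  obtain ⟨-, -, h⟩ | ⟨ht, hw, -⟩ | ⟨ht, -, h⟩ :=
    posTrue_local (M := M) (Γ := Γ) (s := s) hφ₀ p
  · refine ⟨fun _ _ => (hσ p (h.1 hpt)).1, fun hm => ?_⟩
    obtain ⟨q, hq, -⟩ := h.1 hpt
    simp [hm] at hq
  · simp [ht, hw]
  · simp [ht, h.1 hpt]

theorem WinStrat.posTrue (hφ₀ : IsSentence φ₀) {w₀ : W} {σ : GPos W → GPos W}
    (hσ : WinStrat M φ₀ Γ w₀ .eloise σ) {p : GPos W}
    (hp : Acc (fun q p => q ∈ moves M φ₀ Γ p) p) {f : List (GPos W)}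
    (hf : ConsPlay M φ₀ Γ w₀ .eloise σ f) (hfp : f.getLast? = some p) :
    PosTrue M Γ φ₀ s p := by
  induction hp generalizing f with
  | intro p _ ih =>
    obtain ⟨hlegal, hterm⟩ := hσ f hf p hfp
    obtain ⟨ht, hw, h⟩ | ⟨ht, -, h⟩ | ⟨-, hm, h⟩ :=
      posTrue_local (M := M) (Γ := Γ) (s := s) hφ₀ p
    · rcases (moves M φ₀ Γ p).eq_empty_or_nonempty with hm | hm
      · simp [hterm hm] at hw
      · have hq := hlegal ht hm
        exact h.2 ⟨_, hq, ih _ hq (hf.snoc hfp hq fun _ => rfl) (by simp)⟩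
    · exact h.2 fun q hq => ih q hq (hf.snoc hfp hq fun h' => by simp [ht] at h') (by simp)
    · exact h.2 (hterm hm)

end PosTrue

/-- For every ordinal `Γ`, Kripke model `M`, world `w₀` and sentence `φ₀`
of the modal μ-calculus in normal form: `M,w₀ ⊨^Γ φ₀` in the Γ-bounded compositional
semantics (truth of a sentence being independent of the assignment) iff Eloise has a
winning strategy in the Γ-bounded evaluation game `(M, w₀, φ₀, Γ)`. -/
theorem bounded_gts_equiv_bounded_compositional [DecidableEq Λ] [Nonempty W]
    (Γ : Ordinal) (M : Kripke Φ W) (w₀ : W) (φ₀ : Formula Φ Λ)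
    (hsen : IsSentence φ₀) (hnf : NormalForm φ₀) :
    (∀ s, w₀ ∈ bsat M Γ φ₀ s) ↔ ∃ σ, WinStrat M φ₀ Γ w₀ Player.eloise σ := by
  constructor
  · exact fun h => exists_winStrat_of_posTrue hsen (posTrue_initPos.2 (h fun _ => ∅))
  · rintro ⟨σ, hσ⟩ s
    exact posTrue_initPos.1 (hσ.posTrue hsen (acc_initPos M φ₀ Γ w₀) (f := [initPos w₀ Γ])
      ⟨rfl, fun i hi => by simp at hi⟩ rfl)
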